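/- (Jacobi triple product for θ₁) Fix τ ∈ ℂ with Im τ > 0 and set q = exp(2πiτ). Then for every z ∈ ℂ, writing x = exp(2πiz), θ₁(πz|τ) = i·exp(πi(τ/4 − z)) · ( ∏_{j=0}^{∞} (1 − x q^{j}) ) · ( ∏_{j=0}^{∞} (1 − q^{j+1}/x) ) · ( ∏_{j=1}^{∞} (1 − q^{j}) ), where all three infinite products converge absolutely since |q| < 1. -/

import Mathlib

/-- Jacobi theta function θ₁(z|τ), nome q = exp(iπτ). -/
noncomputable def theta1 (z τ : ℂ) : ℂ :=
  2 * ∑' n : ℕ, (-1) ^ n * Complex.exp (Real.pi * Complex.I * τ * ((n : ℂ) + 1 / 2) ^ 2) *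
      Complex.sin ((2 * (n : ℂ) + 1) * z)

/-- The finite product `(q; q)_n = ∏_{j=1}^{n} (1 - q ^ j)`. -/
def qFactorial {R : Type*} [CommRing R] (q : R) (n : ℕ) : R :=
  ∏ j ∈ Finset.range n, (1 - q ^ (j + 1))

/-- The Gaussian binomial coefficient, defined by the `q`-Pascal recursion. -/
def qChoose {R : Type*} [CommRing R] (q : R) : ℕ → ℕ → R
  | _, 0 => 1
  | 0, _ + 1 => 0
  | n + 1, k + 1 => qChoose q n k + q ^ (k + 1) * qChoose q n (k + 1)

section Algebra

variable {R : Type*} [CommRing R] (q : R)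

lemma qFactorial_succ (n : ℕ) : qFactorial q (n + 1) = qFactorial q n * (1 - q ^ (n + 1)) :=
  Finset.prod_range_succ _ _

@[simp] lemma qFactorial_zero : qFactorial q 0 = 1 := rfl

@[simp] lemma qChoose_zero_right (n : ℕ) : qChoose q n 0 = 1 := by
  cases n <;> rfl

lemma qChoose_succ_succ (n k : ℕ) :
    qChoose q (n + 1) (k + 1) = qChoose q n k + q ^ (k + 1) * qChoose q n (k + 1) := rfl

lemma qChoose_eq_zero_of_lt {n k : ℕ} (h : n < k) : qChoose q n k = 0 := by
  induction n generalizing k with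
  | zero => obtain ⟨k, rfl⟩ := Nat.exists_eq_succ_of_ne_zero h.ne'; rfl
  | succ n ih =>
    obtain ⟨k, rfl⟩ := Nat.exists_eq_succ_of_ne_zero (Nat.ne_zero_of_lt h)
    rw [Nat.succ_eq_add_one, qChoose_succ_succ, ih (by omega), ih (by omega)]
    ring

@[simp] lemma qChoose_self (n : ℕ) : qChoose q n n = 1 := by
  induction n with
  | zero => rfl
  | succ n ih => rw [qChoose_succ_succ, ih, qChoose_eq_zero_of_lt q n.lt_succ_self]; ring

lemma qChoose_add_mul_qFactorial (a b : ℕ) :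
    qChoose q (a + b) a * (qFactorial q a * qFactorial q b) = qFactorial q (a + b) := by
  induction h : a + b generalizing a b with
  | zero =>
    obtain ⟨rfl, rfl⟩ : a = 0 ∧ b = 0 := by omega
    simp
  | succ n ih =>
    rcases a with _ | a
    · obtain rfl : b = n + 1 := by omega
      simp
    rcases b with _ | b
    · obtain rfl : a = n := by omega
      simp
    have h₁ := ih a (b + 1) (by omega)
    have h₂ := ih (a + 1) b (by omega)
    obtain rfl : n = a + b + 1 := by omega
    rw [qFactorial_succ] at h₁ h₂
    rw [qChoose_succ_succ, qFactorial_succ, qFactorial_succ, qFactorial_succ q (a + b + 1)]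
    linear_combination (1 - q ^ (a + 1)) * h₁ + q ^ (a + 1) * (1 - q ^ (b + 1)) * h₂

/-- The finite `q`-binomial theorem. -/
lemma prod_one_add_mul_pow (n : ℕ) (y : R) :
    ∏ j ∈ Finset.range n, (1 + y * q ^ j) =
      ∑ k ∈ Finset.range (n + 1), qChoose q n k * (q ^ k.choose 2 * y ^ k) := by
  induction n generalizing y with
  | zero => simp
  | succ n ih =>
    have hshift : ∏ j ∈ Finset.range n, (1 + y * q ^ (j + 1)) =
        ∏ j ∈ Finset.range n, (1 + y * q * q ^ j) :=
      Finset.prod_congr rfl fun j _ ↦ by ring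
    rw [Finset.prod_range_succ', hshift, ih, Finset.sum_range_succ' _ (n + 1)]
    have hC (k : ℕ) : (k + 1).choose 2 = k + k.choose 2 := by
      rw [Nat.choose_succ_succ' k 1, Nat.choose_one_right]
    have hterm : ∀ k ∈ Finset.range (n + 1),
        qChoose q (n + 1) (k + 1) * (q ^ (k + 1).choose 2 * y ^ (k + 1)) =
        qChoose q n k * (q ^ k.choose 2 * (y * q) ^ k) * y +
        qChoose q n (k + 1) * (q ^ (k + 1).choose 2 * (y * q) ^ (k + 1)) := fun k _ ↦ by
      rw [qChoose_succ_succ, hC]; ring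
    rw [Finset.sum_congr rfl hterm, Finset.sum_add_distrib, ← Finset.sum_mul, add_assoc]
    have hlast := Finset.sum_range_succ'
      (fun k ↦ qChoose q n k * (q ^ k.choose 2 * (y * q) ^ k)) (n + 1)
    rw [Finset.sum_range_succ, qChoose_eq_zero_of_lt q n.lt_succ_self] at hlast
    simp only [qChoose_zero_right, pow_zero, mul_one, Nat.choose_zero_succ] at hlast ⊢
    linear_combination hlast

end Algebra

/-- The finite Jacobi triple product: `T m` plays the role of `(-x) ^ m * q ^ (m * (m - 1) / 2)`. -/
lemma prod_mul_prod_eq_sum_qChoose {K : Type*} [Field K] {q x : K} (hq : q ≠ 0) (hx : x ≠ 0)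
    {T : ℤ → K} (hT₀ : T 0 = 1) (hT : ∀ m, T (m + 1) = -(x * q ^ m) * T m) (N : ℕ) :
    (∏ j ∈ Finset.range N, (1 - x * q ^ j)) * ∏ j ∈ Finset.range N, (1 - q ^ (j + 1) / x) =
      ∑ k ∈ Finset.range (2 * N + 1), qChoose q (2 * N) k * T (k - N) := by
  have hterm (k : ℕ) : T (k - N) =
      q ^ k.choose 2 * (-(x * q ^ (-N : ℤ))) ^ k * T (-N) := by
    induction k with
    | zero => simp
    | succ k ih =>
      have h : ((k + 1 : ℕ) : ℤ) - N = (k - N) + 1 := by push_cast; ring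
      rw [h, hT, ih, Nat.choose_succ_succ' k 1, Nat.choose_one_right, sub_eq_add_neg,
        zpow_add₀ hq, zpow_natCast]
      ring
  have hreflect (M : ℕ) : (∏ j ∈ Finset.range M, (1 - x * q ^ (-(j + 1) : ℤ))) * T (-M) =
      ∏ j ∈ Finset.range M, (1 - q ^ (j + 1) / x) := by
    induction M with
    | zero => simpa using hT₀
    | succ M ih =>
      have h := hT (-(M + 1))
      rw [show (-(M + 1) + 1 : ℤ) = -M by ring] at h
      rw [Finset.prod_range_succ, Finset.prod_range_succ, ← ih, h]
      have h' : q ^ (-(M + 1) : ℤ) = (q ^ (M + 1))⁻¹ := by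
        rw [zpow_neg]; norm_cast
      push_cast
      rw [h']
      field_simp
      ring
  have hprod : ∏ j ∈ Finset.range (2 * N), (1 + -(x * q ^ (-N : ℤ)) * q ^ j) =
      (∏ j ∈ Finset.range N, (1 - x * q ^ (-(j + 1) : ℤ))) *
        ∏ j ∈ Finset.range N, (1 - x * q ^ j) := by
    rw [two_mul, Finset.prod_range_add]
    congr 1
    · rw [← Finset.prod_range_reflect]
      refine Finset.prod_congr rfl fun j hj ↦ ?_
      have hj' : j + 1 ≤ N := Finset.mem_range.mp hj
      rw [neg_mul, mul_assoc, ← zpow_natCast, ← zpow_add₀ hq, ← sub_eq_add_neg]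
      congr 3
      omega
    · refine Finset.prod_congr rfl fun j _ ↦ ?_
      rw [pow_add, zpow_neg, zpow_natCast]
      field_simp
      ring
  simp_rw [hterm, ← mul_assoc]
  rw [← Finset.sum_mul]
  simp_rw [mul_assoc]
  rw [← prod_one_add_mul_pow, hprod, ← hreflect]
  ring

open Filter Topology

section Limit

variable {q : ℂ}

lemma summable_norm_const_mul_pow (hq : ‖q‖ < 1) (c : ℂ) : Summable fun j : ℕ ↦ ‖-(c * q ^ j)‖ := by
  simpa using (summable_geometric_of_lt_one (norm_nonneg q) hq).mul_left ‖c‖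

lemma tendsto_prod_one_sub_mul_pow (hq : ‖q‖ < 1) (c : ℂ) :
    Tendsto (fun n ↦ ∏ j ∈ Finset.range n, (1 - c * q ^ j)) atTop
      (𝓝 (∏' j : ℕ, (1 - c * q ^ j))) := by
  have h := multipliable_one_add_of_summable (summable_norm_const_mul_pow hq c)
  simpa only [sub_eq_add_neg] using h.hasProd.tendsto_prod_nat

lemma one_sub_pow_succ_ne_zero (hq : ‖q‖ < 1) (j : ℕ) : 1 - q ^ (j + 1) ≠ 0 := by
  intro h
  have h' : ‖q ^ (j + 1)‖ = 1 := by rw [← sub_eq_zero.mp h, norm_one]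
  rw [norm_pow] at h'
  exact (pow_lt_one₀ (norm_nonneg q) hq j.succ_ne_zero).ne h'

lemma qFactorial_ne_zero (hq : ‖q‖ < 1) (n : ℕ) : qFactorial q n ≠ 0 :=
  Finset.prod_ne_zero_iff.mpr fun j _ ↦ one_sub_pow_succ_ne_zero hq j

lemma tendsto_qFactorial (hq : ‖q‖ < 1) :
    Tendsto (qFactorial q) atTop (𝓝 (∏' j : ℕ, (1 - q ^ (j + 1)))) := by
  have h := tendsto_prod_one_sub_mul_pow hq q
  simp only [← pow_succ'] at h
  exact h

lemma tprod_one_sub_pow_succ_ne_zero (hq : ‖q‖ < 1) : ∏' j : ℕ, (1 - q ^ (j + 1)) ≠ 0 := by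
  have h := tprod_one_add_ne_zero_of_summable (f := fun j : ℕ ↦ -(q * q ^ j))
    (fun j ↦ by simpa only [← pow_succ', ← sub_eq_add_neg] using one_sub_pow_succ_ne_zero hq j)
    (summable_norm_const_mul_pow hq q)
  simpa only [← pow_succ', ← sub_eq_add_neg] using h

lemma qChoose_add (hq : ‖q‖ < 1) (a b : ℕ) :
    qChoose q (a + b) a = qFactorial q (a + b) * ((qFactorial q a)⁻¹ * (qFactorial q b)⁻¹) := by
  have ha := qFactorial_ne_zero hq a
  have hb := qFactorial_ne_zero hq b
  rw [← qChoose_add_mul_qFactorial]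
  field_simp

lemma exists_norm_qChoose_le (hq : ‖q‖ < 1) : ∃ C, ∀ n k, ‖qChoose q n k‖ ≤ C := by
  have hlim := tendsto_qFactorial hq
  obtain ⟨A, hA⟩ := hlim.norm.bddAbove_range
  obtain ⟨B, hB⟩ := (hlim.inv₀ (tprod_one_sub_pow_succ_ne_zero hq)).norm.bddAbove_range
  replace hA (n : ℕ) : ‖qFactorial q n‖ ≤ A := hA ⟨n, rfl⟩
  replace hB (n : ℕ) : ‖(qFactorial q n)⁻¹‖ ≤ B := hB ⟨n, rfl⟩
  have hA₀ : 0 ≤ A := (norm_nonneg _).trans (hA 0)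
  have hB₀ : 0 ≤ B := (norm_nonneg _).trans (hB 0)
  refine ⟨A * (B * B), fun n k ↦ ?_⟩
  rcases lt_or_ge n k with h | h
  · rw [qChoose_eq_zero_of_lt q h, norm_zero]
    positivity
  · obtain ⟨b, rfl⟩ := Nat.exists_eq_add_of_le h
    rw [qChoose_add hq, norm_mul, norm_mul]
    gcongr
    exacts [hA _, hB _, hB _]

lemma tendsto_qChoose_central (hq : ‖q‖ < 1) (m : ℤ) :
    Tendsto (fun N : ℕ ↦ qChoose q (2 * N) (m + N).toNat) atTop
      (𝓝 (∏' j : ℕ, (1 - q ^ (j + 1)))⁻¹) := by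
  set P := ∏' j : ℕ, (1 - q ^ (j + 1))
  have hP : P ≠ 0 := tprod_one_sub_pow_succ_ne_zero hq
  have hlim := tendsto_qFactorial hq
  have hinv := hlim.inv₀ hP
  have hshift (r : ℤ) : Tendsto (fun N : ℕ ↦ (r + N).toNat) atTop atTop :=
    tendsto_atTop.mpr fun b ↦ by
      filter_upwards [eventually_ge_atTop (b + r.natAbs)] with N hN
      omega
  have h := (hlim.comp (tendsto_id.const_mul_atTop' two_pos)).mul
    ((hinv.comp (hshift m)).mul (hinv.comp (hshift (-m))))
  rw [show P * (P⁻¹ * P⁻¹) = P⁻¹ by field_simp] at h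
  refine h.congr' ?_
  filter_upwards [eventually_ge_atTop m.natAbs] with N hN
  have hN' : 2 * N = (m + N).toNat + (-m + N).toNat := by omega
  simp only [Function.comp_apply, id_eq]
  rw [hN', qChoose_add hq]

/-- The Jacobi triple product: `T m` plays the role of `(-x) ^ m * q ^ (m * (m - 1) / 2)`. -/
lemma tsum_eq_triple_product (hq₀ : q ≠ 0) (hq : ‖q‖ < 1) {x : ℂ} (hx : x ≠ 0) {T : ℤ → ℂ}
    (hT₀ : T 0 = 1) (hT : ∀ m, T (m + 1) = -(x * q ^ m) * T m) (hsum : Summable T) :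
    ∑' m, T m = (∏' j : ℕ, (1 - x * q ^ j)) * (∏' j : ℕ, (1 - q ^ (j + 1) / x)) *
      ∏' j : ℕ, (1 - q ^ (j + 1)) := by
  have hP := tprod_one_sub_pow_succ_ne_zero hq
  obtain ⟨C, hC⟩ := exists_norm_qChoose_le hq
  let F (N : ℕ) (m : ℤ) : ℂ := if -N ≤ m then qChoose q (2 * N) (m + N).toNat * T m else 0
  have hF (N : ℕ) : ∑' m, F N m =
      (∏ j ∈ Finset.range N, (1 - x * q ^ j)) * ∏ j ∈ Finset.range N, (1 - q ^ (j + 1) / x) := by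
    have hinj : Function.Injective fun k : ℕ ↦ (k - N : ℤ) := fun a b h ↦ by
      simpa using h
    have hsupp : Function.support (F N) ⊆ Set.range fun k : ℕ ↦ (k - N : ℤ) := fun m hm ↦ by
      have hm' : -N ≤ m := by
        by_contra h
        exact hm (if_neg h)
      exact ⟨(m + N).toNat, by dsimp only; omega⟩
    have hFk (k : ℕ) : F N (k - N) = qChoose q (2 * N) k * T (k - N) := by
      have h : (-N : ℤ) ≤ k - N := by omega
      simp only [F, if_pos h, sub_add_cancel, Int.toNat_natCast]
    rw [prod_mul_prod_eq_sum_qChoose hq₀ hx hT₀ hT, ← hinj.tsum_eq hsupp]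
    simp_rw [hFk]
    refine tsum_eq_sum fun k hk ↦ ?_
    rw [qChoose_eq_zero_of_lt q (by simpa using hk), zero_mul]
  have hlim : Tendsto (fun N ↦ ∑' m, F N m) atTop
      (𝓝 (∑' m, (∏' j : ℕ, (1 - q ^ (j + 1)))⁻¹ * T m)) := by
    refine tendsto_tsum_of_dominated_convergence (hsum.norm.mul_left C) (fun m ↦ ?_)
      (Eventually.of_forall fun N m ↦ ?_)
    · refine ((tendsto_qChoose_central hq m).mul_const (T m)).congr' ?_
      filter_upwards [eventually_ge_atTop m.natAbs] with N hN
      have h : -(N : ℤ) ≤ m := by omega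
      simp only [F, if_pos h]
    · have hC₀ : 0 ≤ C := (norm_nonneg _).trans (hC 0 0)
      by_cases h : -(N : ℤ) ≤ m
      · simp only [F, if_pos h, norm_mul]
        gcongr
        exact hC _ _
      · simp only [F, if_neg h, norm_zero]
        positivity
  simp_rw [hF] at hlim
  have hprod₂ : Tendsto (fun N ↦ ∏ j ∈ Finset.range N, (1 - q ^ (j + 1) / x)) atTop
      (𝓝 (∏' j : ℕ, (1 - q ^ (j + 1) / x))) := by
    simpa only [pow_succ', mul_div_right_comm] using tendsto_prod_one_sub_mul_pow hq (q / x)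
  have h := tendsto_nhds_unique hlim ((tendsto_prod_one_sub_mul_pow hq x).mul hprod₂)
  rw [← h, tsum_mul_left]
  field_simp

end Limit

lemma theta1_pi_mul_eq_jacobiTheta₂ (τ : ℂ) (hτ : 0 < τ.im) (z : ℂ) :
    theta1 (Real.pi * z) τ = Complex.I * Complex.exp (Real.pi * Complex.I * (τ / 4 - z)) *
      ∑' m : ℤ, jacobiTheta₂_term m (z + 1 / 2 - τ / 2) τ := by
  have hsum := (summable_jacobiTheta₂_term_iff (z + 1 / 2 - τ / 2) τ).mpr hτ
  have hpair := ((Equiv.neg ℤ).hasSum_iff.mpr hsum.hasSum).nat_add_neg_add_one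
  rw [theta1, ← tsum_mul_left, ← hpair.tsum_eq, ← tsum_mul_left]
  refine tsum_congr fun n ↦ ?_
  have hsign : Complex.exp (n * (Real.pi * Complex.I)) = (-1) ^ n := by
    rw [Complex.exp_nat_mul, Complex.exp_pi_mul_I]
  have hsign' : Complex.exp (-(n * (Real.pi * Complex.I))) = (-1) ^ n := by
    rw [Complex.exp_neg, hsign, ← inv_pow]
    norm_num
  set E := Complex.exp (Real.pi * Complex.I * τ * ((n : ℂ) + 1 / 2) ^ 2)
  set w : ℂ := (2 * (n : ℂ) + 1) * (Real.pi * z)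
  have h₁ : Complex.exp (Real.pi * Complex.I * (τ / 4 - z)) *
      jacobiTheta₂_term (-n) (z + 1 / 2 - τ / 2) τ =
      (-1) ^ n * E * Complex.exp (-w * Complex.I) := by
    rw [← hsign', jacobiTheta₂_term, ← Complex.exp_add, ← Complex.exp_add, ← Complex.exp_add]
    congr 1
    push_cast
    ring
  have h₂ : Complex.exp (Real.pi * Complex.I * (τ / 4 - z)) *
      jacobiTheta₂_term (n + 1) (z + 1 / 2 - τ / 2) τ =
      -((-1) ^ n * E * Complex.exp (w * Complex.I)) := by
    have h : -((-1) ^ n * E * Complex.exp (w * Complex.I)) =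
        Complex.exp (Real.pi * Complex.I) * ((-1) ^ n * E * Complex.exp (w * Complex.I)) := by
      rw [Complex.exp_pi_mul_I]; ring
    rw [h, ← hsign, jacobiTheta₂_term, ← Complex.exp_add, ← Complex.exp_add, ← Complex.exp_add,
      ← Complex.exp_add]
    congr 1
    push_cast
    ring
  simp only [Function.comp_apply, Equiv.neg_apply, neg_neg]
  rw [Complex.sin]
  linear_combination -Complex.I * h₁ - Complex.I * h₂

/-- Jacobi triple product for θ₁, with q = exp(2πiτ) and x = exp(2πiz). -/
theorem theta1_triple_product (τ : ℂ) (hτ : 0 < τ.im) (z : ℂ) :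
    theta1 ((Real.pi : ℂ) * z) τ =
      Complex.I * Complex.exp ((Real.pi : ℂ) * Complex.I * (τ / 4 - z)) *
        (∏' j : ℕ, (1 - Complex.exp (2 * (Real.pi : ℂ) * Complex.I * z) *
          Complex.exp (2 * (Real.pi : ℂ) * Complex.I * τ) ^ j)) *
        (∏' j : ℕ, (1 - Complex.exp (2 * (Real.pi : ℂ) * Complex.I * τ) ^ (j + 1) /
          Complex.exp (2 * (Real.pi : ℂ) * Complex.I * z))) *
        (∏' j : ℕ, (1 - Complex.exp (2 * (Real.pi : ℂ) * Complex.I * τ) ^ (j + 1))) := by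
  have hq : ‖Complex.exp (2 * (Real.pi : ℂ) * Complex.I * τ)‖ < 1 := by
    rw [Complex.norm_exp, Real.exp_lt_one_iff]
    have h : (2 * (Real.pi : ℂ) * Complex.I * τ).re = -(2 * Real.pi * τ.im) := by simp
    rw [h]
    have := Real.pi_pos
    rw [neg_lt_zero]
    positivity
  rw [theta1_pi_mul_eq_jacobiTheta₂ τ hτ, tsum_eq_triple_product (Complex.exp_ne_zero _) hq
    (Complex.exp_ne_zero (2 * (Real.pi : ℂ) * Complex.I * z)) (by simp [jacobiTheta₂_term])
    (fun m ↦ ?_) ((summable_jacobiTheta₂_term_iff _ _).mpr hτ)]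
  · ring
  · rw [← neg_one_mul (_ * _), ← Complex.exp_pi_mul_I, ← Complex.exp_int_mul, jacobiTheta₂_term,
      jacobiTheta₂_term, ← Complex.exp_add, ← Complex.exp_add, ← Complex.exp_add]
    congr 1
    push_cast
    ring
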